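/- arXiv:2604.07186 — 2 statements merged into one kernel-verified Lean document; each statement's English description precedes it below -/
import Mathlib

section
/- Let W ∈ 𝒲* and suppose log W(N)/log N → 0 as N → ∞. Then the supremum, over all functions f : ℕ → ℂ with ‖f‖∞ ≤ 1, of | E^W_{n≤N} ( E_{k≤n} f(k) ) − E^W_{n≤N} f(n) | tends to 0 as N → ∞. -/
open Filter Finset

/-- Discrete derivative: `ΔW(N) = W(N) - W(N-1)` for `N ≥ 2`, and `ΔW(1) = W(1)`. -/
noncomputable def dd (W : ℕ → ℝ) (N : ℕ) : ℝ := if 2 ≤ N then W N - W (N - 1) else W 1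

/-- Weighted average `E^W_{n ≤ N} f(n) = (1/W(N)) ∑_{n=1}^N ΔW(n) f(n)`. -/
noncomputable def wAvg (W : ℕ → ℝ) (f : ℕ → ℂ) (N : ℕ) : ℂ :=
  (1 / (W N : ℂ)) * ∑ n ∈ Finset.Icc 1 N, (dd W n : ℂ) * f n

/-- Cesàro average `E_{n ≤ N} f(n) = (1/N) ∑_{n=1}^N f(n)`. -/
noncomputable def cesaro (f : ℕ → ℂ) (N : ℕ) : ℂ :=
  (1 / (N : ℂ)) * ∑ n ∈ Finset.Icc 1 N, f n

/-- Parity-neutral binomial mean. -/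
noncomputable def e2bin (f : ℕ → ℂ) (N : ℕ) : ℂ :=
  (1 / 2 ^ (N + 1) : ℂ) * ∑ n ∈ Finset.Icc 1 (2 * N), (Nat.choose N (n / 2) : ℂ) * f n

/-- Binomial mean. -/
noncomputable def ebin (f : ℕ → ℂ) (N : ℕ) : ℂ :=
  (1 / 2 ^ N : ℂ) * ∑ n ∈ Finset.Icc 1 N, (Nat.choose N n : ℂ) * f n

/-- The class 𝒲: eventually non-decreasing nonnegative functions tending to ∞. -/
def memW (W : ℕ → ℝ) : Prop :=
  (∀ n, 0 ≤ W n) ∧ (∃ N₀ : ℕ, ∀ m n : ℕ, N₀ ≤ m → m ≤ n → W m ≤ W n) ∧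
    Tendsto W atTop atTop

/-- The class 𝒲*: members of 𝒲 for which `N·Δ²W(N)/ΔW(N)` converges in `ℝ ∪ {±∞}`. -/
def memWstar (W : ℕ → ℝ) : Prop :=
  memW W ∧ ∃ l : EReal,
    Tendsto (fun N : ℕ => (((N : ℝ) * dd (dd W) N / dd W N : ℝ) : EReal)) atTop (nhds l)

/-- The class ℒ: members of 𝒲 (with values in ℕ) whose discrete derivative is
eventually in {0,1}. -/
def memL (L : ℕ → ℕ) : Prop :=
  memW (fun n => (L n : ℝ)) ∧
    ∃ N₀ : ℕ, ∀ n : ℕ, N₀ ≤ n → L n = L (n - 1) ∨ L n = L (n - 1) + 1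

/-- Gaussian probability density with mean μ and standard deviation σ. -/
noncomputable def gauss (x μ σ : ℝ) : ℝ :=
  (1 / (σ * Real.sqrt (2 * Real.pi))) * Real.exp (-(x - μ) ^ 2 / (2 * σ ^ 2))

/-- The Gaussian condition \eqref{gaussian_condition}. -/
def gaussCond (ϑ : ℕ → ℕ) (L : ℕ → ℕ) : Prop :=
  Tendsto (fun N : ℕ => ∑' k : ℕ,
      |(((Finset.Icc 1 N).filter (fun n => ϑ n = k + 1)).card : ℝ) / N -
        gauss (k + 1 : ℝ) (L N) (Real.sqrt (L N))|) atTop (nhds 0)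

/-- Ω(n): number of prime factors with multiplicity. -/
def bigOmega (n : ℕ) : ℕ := n.primeFactorsList.length

/-- ω(n): number of distinct prime factors. -/
def smallOmega (n : ℕ) : ℕ := n.primeFactors.card

/-- Uniform distribution mod 1. -/
def udMod1 (x : ℕ → ℝ) : Prop :=
  ∀ a b : ℝ, 0 ≤ a → a < b → b ≤ 1 →
    Tendsto (fun N : ℕ =>
        (((Finset.Icc 1 N).filter
            (fun n => a ≤ Int.fract (x n) ∧ Int.fract (x n) < b)).card : ℝ) / N)
      atTop (nhds (b - a))

theorem dd_succ (W : ℕ → ℝ) {n : ℕ} (hn : 1 ≤ n) : dd W (n + 1) = W (n + 1) - W n := by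
  simp [dd, hn]

theorem sum_dd (W : ℕ → ℝ) {N : ℕ} (hN : 1 ≤ N) : ∑ n ∈ Icc 1 N, dd W n = W N := by
  induction N, hN using Nat.le_induction with
  | base => simp [dd]
  | succ n hn ih => rw [sum_Icc_succ_top (by omega), ih, dd_succ W hn]; ring

/-- The weight that `f k` receives in `W N * (E^W (E f) - E^W f)`. -/
noncomputable def diffWeight (W : ℕ → ℝ) (N k : ℕ) : ℝ :=
  ∑ n ∈ Icc k N, dd W n / n - dd W k

theorem wAvg_cesaro_sub_wAvg (W : ℕ → ℝ) (f : ℕ → ℂ) (N : ℕ) :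
    wAvg W (fun n => cesaro f n) N - wAvg W f N =
      1 / (W N : ℂ) * ∑ k ∈ Icc 1 N, (diffWeight W N k : ℂ) * f k := by
  have h : ∑ n ∈ Icc 1 N, (dd W n : ℂ) * cesaro f n =
      ∑ k ∈ Icc 1 N, ∑ n ∈ Icc k N, (dd W n : ℂ) / n * f k := by
    simp only [cesaro, mul_sum]
    rw [sum_comm' (t' := Icc 1 N) (s' := fun k => Icc k N)
      (by intro x y; simp only [mem_Icc]; omega)]
    exact sum_congr rfl fun k _ => sum_congr rfl fun n _ => by ring
  simp only [wAvg]
  rw [h, ← mul_sub, ← sum_sub_distrib]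
  congr 1
  refine sum_congr rfl fun k _ => ?_
  simp only [diffWeight]
  push_cast
  rw [sub_mul, sum_mul]

theorem sum_diffWeight (W : ℕ → ℝ) (N : ℕ) : ∑ k ∈ Icc 1 N, diffWeight W N k = 0 := by
  simp only [diffWeight]
  rw [sum_sub_distrib, sub_eq_zero, sum_comm' (t' := Icc 1 N) (s' := fun n => Icc 1 n)
    (by intro x y; simp only [mem_Icc]; omega)]
  refine sum_congr rfl fun n hn => ?_
  have : (n : ℝ) ≠ 0 := by have := (mem_Icc.1 hn).1; positivity
  simp only [sum_const, Nat.card_Icc, nsmul_eq_mul, Nat.add_sub_cancel]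
  field_simp

theorem norm_wAvg_cesaro_sub_wAvg_le (W : ℕ → ℝ) (f : ℕ → ℂ) (hf : ∀ n, ‖f n‖ ≤ 1) {N : ℕ}
    (hN : 0 < W N) {u : ℕ → ℝ} (hu0 : ∀ k ∈ Icc 1 N, 0 ≤ u k)
    (hu : ∀ k ∈ Icc 1 N, diffWeight W N k ≤ u k) :
    ‖wAvg W (fun n => cesaro f n) N - wAvg W f N‖ ≤ 2 * (∑ k ∈ Icc 1 N, u k) / W N := by
  rw [wAvg_cesaro_sub_wAvg, norm_mul, norm_div, norm_one, Complex.norm_real,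
    Real.norm_of_nonneg hN.le, one_div, inv_mul_eq_div]
  gcongr
  calc ‖∑ k ∈ Icc 1 N, (diffWeight W N k : ℂ) * f k‖
      ≤ ∑ k ∈ Icc 1 N, (2 * u k - diffWeight W N k) := by
        refine norm_sum_le_of_le _ fun k hk => ?_
        rw [norm_mul, Complex.norm_real, Real.norm_eq_abs]
        refine (mul_le_of_le_one_right (abs_nonneg _) (hf k)).trans ?_
        have h0 := hu0 k hk
        have h1 := hu k hk
        exact abs_le.2 ⟨by linarith, by linarith⟩
    _ = 2 * ∑ k ∈ Icc 1 N, u k := by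
        rw [sum_sub_distrib, sum_diffWeight, sub_zero, mul_sum]

theorem sum_dd_div_le (W : ℕ → ℝ) {η : ℝ} {K N : ℕ} (hN : 0 ≤ dd W N) (hη : 0 ≤ η)
    (hK : ∀ n, K ≤ n → dd W (n + 1) / (n + 1 : ℕ) ≤ (1 + η) * (dd W n - dd W (n + 1)))
    (hK' : ∀ n, K ≤ n → dd W n / n ≤ η * dd W n) {k : ℕ} (hk : K ≤ k) (hkN : k ≤ N) :
    ∑ n ∈ Icc k N, dd W n / n ≤ (1 + 2 * η) * dd W k := by
  have h : ∑ n ∈ Icc k N, dd W n / n ≤ (1 + 2 * η) * dd W k - (1 + η) * dd W N := by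
    clear hN
    induction N, hkN using Nat.le_induction with
    | base =>
      have := hK' k hk
      rw [Icc_self, sum_singleton]
      linarith
    | succ n hn ih =>
      rw [sum_Icc_succ_top (by omega)]
      linarith [hK n (hk.trans hn)]
  have : 0 ≤ (1 + η) * dd W N := by positivity
  linarith

theorem eventually_average_close (W : ℕ → ℝ) (hW : Tendsto W atTop atTop) {η : ℝ} (hη : 0 < η)
    (hpos : ∀ᶠ n in atTop, 0 ≤ dd W n)
    (hdec : ∀ᶠ n in atTop,
      dd W (n + 1) / (n + 1 : ℕ) ≤ (1 + η) * (dd W n - dd W (n + 1))) :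
    ∀ᶠ N in atTop, ∀ f : ℕ → ℂ, (∀ n, ‖f n‖ ≤ 1) →
      ‖wAvg W (fun n => cesaro f n) N - wAvg W f N‖ ≤ 5 * η := by
  have hinv : ∀ᶠ n : ℕ in atTop, dd W n / n ≤ η * dd W n := by
    have := tendsto_inv_atTop_nhds_zero_nat (𝕜 := ℝ)
    filter_upwards [hpos, this.eventually_lt_const hη] with n hn h
    rw [div_eq_inv_mul]
    gcongr
  obtain ⟨K, hK⟩ := eventually_atTop.1 (hpos.and (hdec.and hinv))
  set S := ∑ n ∈ range K, |dd W n / n|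
  set D : ℕ → ℝ := fun k => S + (1 + 2 * η) * dd W K + (1 + 2 * η) * |dd W k|
  have hS : 0 ≤ S := sum_nonneg fun _ _ => abs_nonneg _
  have hwK : 0 ≤ dd W K := (hK K le_rfl).1
  have hD : ∀ k, 0 ≤ D k := fun k => by positivity
  set C := ∑ k ∈ range K, D k
  filter_upwards [eventually_ge_atTop (K + 1), hW.eventually_gt_atTop 0,
    hW.eventually_ge_atTop (2 * C / η)] with N hNK hN hNC f hf
  have hsum : ∀ k, K ≤ k → k ≤ N → ∑ n ∈ Icc k N, dd W n / n ≤ (1 + 2 * η) * dd W k :=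
    fun k hk hkN => sum_dd_div_le W (hK N (by omega)).1 hη.le (fun n hn => (hK n hn).2.1)
      (fun n hn => (hK n hn).2.2) hk hkN
  set u : ℕ → ℝ := fun k => 2 * η * dd W k + if k < K then D k else 0
  have hu : ∀ k ∈ Icc 1 N, 0 ≤ u k ∧ diffWeight W N k ≤ u k := by
    intro k hk
    simp only [u, diffWeight]
    split_ifs with hkK
    · have h1 : ∑ n ∈ Icc k N, dd W n / n ≤ S + (1 + 2 * η) * dd W K := by
        have hsub : Icc k N = Ico k K ∪ Icc K N := by
          ext n; simp only [mem_union, mem_Icc, mem_Ico]; omega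
        rw [hsub, sum_union (disjoint_left.2 fun n => by simp only [mem_Icc, mem_Ico]; omega)]
        refine add_le_add ?_ (hsum K le_rfl (by omega))
        refine (sum_le_sum fun n _ => le_abs_self _).trans ?_
        refine sum_le_sum_of_subset_of_nonneg (fun n => ?_) fun _ _ _ => abs_nonneg _
        simp only [mem_range, mem_Ico]; omega
      have h2 : 0 ≤ (1 + 2 * η) * dd W K := by positivity
      have h3 : 0 ≤ η * (|dd W k| + dd W k) :=
        mul_nonneg hη.le (by linarith [neg_abs_le (dd W k)])
      have h4 := neg_abs_le (dd W k)
      have h5 := abs_nonneg (dd W k)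
      constructor <;> simp only [D] <;> linarith
    · have h1 : 0 ≤ η * dd W k := mul_nonneg hη.le (hK k (by omega)).1
      have h2 := hsum k (by omega) (mem_Icc.1 hk).2
      constructor <;> linarith
  refine (norm_wAvg_cesaro_sub_wAvg_le W f hf hN (fun k hk => (hu k hk).1)
    fun k hk => (hu k hk).2).trans ?_
  have hsumu : ∑ k ∈ Icc 1 N, u k ≤ 2 * η * W N + C := by
    simp only [u]
    rw [sum_add_distrib, ← mul_sum, sum_dd W (by omega), ← sum_filter]
    gcongr
    refine sum_le_sum_of_subset_of_nonneg (fun n => ?_) fun k _ _ => hD k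
    simp
  rw [div_le_iff₀ hη] at hNC
  rw [div_le_iff₀ hN]
  linarith

theorem eventually_dd_nonneg {W : ℕ → ℝ} (hW : memW W) : ∀ᶠ n in atTop, 0 ≤ dd W n := by
  obtain ⟨N₀, h⟩ := hW.2.1
  filter_upwards [eventually_ge_atTop (N₀ + 2)] with n hn
  rw [dd, if_pos (by omega)]
  linarith [h (n - 1) n (by omega) (by omega)]

theorem eventually_dd_pos {W : ℕ → ℝ} (hW : memW W) {l : EReal}
    (hl : Tendsto (fun N : ℕ => (((N : ℝ) * dd (dd W) N / dd W N : ℝ) : EReal)) atTop (nhds l)) :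
    ∀ᶠ n in atTop, 0 < dd W n := by
  suffices h : ∀ᶠ n in atTop, dd W n ≠ 0 by
    filter_upwards [h, eventually_dd_nonneg hW] with n h1 h2 using h2.lt_of_ne' h1
  by_cases hl0 : l = 0
  · subst hl0
    have h1 : ∀ᶠ N : ℕ in atTop, (N : ℝ) * dd (dd W) N / dd W N < 1 := by
      filter_upwards [hl.eventually_lt_const (u := ((1 : ℝ) : EReal)) (by norm_num)] with N hN
      exact_mod_cast hN
    obtain ⟨M, hM⟩ := eventually_atTop.1 (h1.and (eventually_ge_atTop 1))
    refine eventually_atTop.2 ⟨M, fun m hm hm0 => ?_⟩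
    have hzero : ∀ n, m ≤ n → dd W n = 0 ∧ W n = W m := by
      intro n hn
      induction n, hn using Nat.le_induction with
      | base => exact ⟨hm0, rfl⟩
      | succ n hn ih =>
        have hn1 := (hM n (hm.trans hn)).2
        have h0 : dd W (n + 1) = 0 := by
          by_contra hne
          have hr := (hM (n + 1) (by omega)).1
          rw [dd_succ _ hn1, ih.1, sub_zero, mul_div_cancel_right₀ _ hne] at hr
          push_cast at hr
          linarith [(Nat.cast_nonneg n : (0 : ℝ) ≤ n)]
        refine ⟨h0, ?_⟩
        rw [dd_succ W hn1] at h0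
        linarith [ih.2]
    obtain ⟨n, hn, hgt⟩ := ((eventually_ge_atTop m).and (hW.2.2.eventually_gt_atTop (W m))).exists
    linarith [(hzero n hn).2]
  · filter_upwards [hl.eventually_ne hl0] with n hn h0
    simp [h0] at hn

theorem exists_dd_ge_of_ratio_gt {W : ℕ → ℝ} (hW : Tendsto W atTop atTop) {δ : ℝ} (hδ : 0 < δ)
    (h : ∀ᶠ n : ℕ in atTop, δ * dd W (n + 1) ≤ (n + 2) * dd W (n + 1) - (n + 1) * dd W n) :
    ∀ᶠ n : ℕ in atTop, δ / 2 * W n ≤ (n + 1) * dd W n := by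
  obtain ⟨K, hK⟩ := eventually_atTop.1 (h.and (eventually_ge_atTop 1))
  have hmono : ∀ n : ℕ, K ≤ n →
      (K + 1) * dd W K - δ * W K ≤ (n + 1) * dd W n - δ * W n := by
    intro n hn
    induction n, hn using Nat.le_induction with
    | base => exact le_rfl
    | succ n hn ih =>
      have h1 := (hK n hn).1
      have h2 : δ * dd W (n + 1) = δ * W (n + 1) - δ * W n := by
        rw [dd_succ W (hK n hn).2]; ring
      push_cast
      linarith
  filter_upwards [eventually_ge_atTop K,
    hW.eventually_ge_atTop (-((K + 1) * dd W K - δ * W K) / (δ / 2))] with n hn hWn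
  rw [div_le_iff₀ (by positivity)] at hWn
  linarith [hmono n hn]

theorem not_tendsto_log_div_log {W : ℕ → ℝ} (hW : Tendsto W atTop atTop) {δ : ℝ} (hδ : 0 < δ)
    (h : ∀ᶠ n : ℕ in atTop, δ * W n ≤ (n + 1) * dd W n) :
    ¬ Tendsto (fun N : ℕ => Real.log (W N) / Real.log N) atTop (nhds 0) := by
  intro hlog
  obtain ⟨K, hK⟩ := eventually_atTop.1
    (h.and ((eventually_ge_atTop 1).and (hW.eventually_gt_atTop 0)))
  have hmono : ∀ n : ℕ, K ≤ n →
      Real.log (W K) - δ * Real.log (K + 2) ≤ Real.log (W n) - δ * Real.log (n + 2) := by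
    intro n hn
    induction n, hn using Nat.le_induction with
    | base => exact le_rfl
    | succ n hn ih =>
      obtain ⟨-, hn1, hWn⟩ := hK n hn
      obtain ⟨hd, -, hWn'⟩ := hK (n + 1) (by omega)
      rw [dd_succ W hn1] at hd
      push_cast at hd ⊢
      have h1 := Real.one_sub_inv_le_log_of_pos (div_pos hWn' hWn)
      rw [Real.log_div hWn'.ne' hWn.ne', inv_div] at h1
      have h2 : δ / (n + 1 + 1) ≤ 1 - W n / W (n + 1) := by
        rw [one_sub_div hWn'.ne', div_le_div_iff₀ (by positivity) hWn']
        linarith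
      have h3 : Real.log (n + 1 + 2) - Real.log (n + 2) ≤ 1 / (n + 1 + 1) := by
        rw [← Real.log_div (by positivity) (by positivity)]
        refine (Real.log_le_sub_one_of_pos (by positivity)).trans (le_of_eq ?_)
        field_simp
        ring
      have h4 := mul_le_mul_of_nonneg_left h3 hδ.le
      rw [mul_one_div] at h4
      linarith
  set b := Real.log (W K) - δ * Real.log (K + 2)
  have hlogtop : Tendsto (fun n : ℕ => Real.log n) atTop atTop :=
    Real.tendsto_log_atTop.comp tendsto_natCast_atTop_atTop
  obtain ⟨n, hn, hn1, hn0, hlt, hb⟩ := ((eventually_ge_atTop K).and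
    ((eventually_ge_atTop 1).and ((hlogtop.eventually_gt_atTop 0).and
    ((hlog.eventually_lt_const (half_pos hδ)).and
    (hlogtop.eventually_gt_atTop (-b / (δ / 2))))))).exists
  rw [div_lt_iff₀ hn0] at hlt
  rw [div_lt_iff₀ (half_pos hδ)] at hb
  have hle : Real.log n ≤ Real.log (n + 2) :=
    Real.log_le_log (by exact_mod_cast hn1) (by linarith)
  have := mul_le_mul_of_nonneg_left hle hδ.le
  linarith [hmono n hn]

/-- Boshernitzan's lemma: if `W ∈ 𝒲*` and `log W(N)/log N → 0`, then
uniformly over `f` with `‖f‖_∞ ≤ 1`, `E^W_{n≤N}(E_{k≤n} f(k)) = E^W_{n≤N} f(n) + o(1)`. -/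
theorem stmt9 (W : ℕ → ℝ) (hW : memWstar W)
    (hlog : Tendsto (fun N : ℕ => Real.log (W N) / Real.log N) atTop (nhds 0)) :
    ∀ ε : ℝ, 0 < ε → ∀ᶠ N : ℕ in atTop, ∀ f : ℕ → ℂ, (∀ n, ‖f n‖ ≤ 1) →
      ‖wAvg W (fun n => cesaro f n) N - wAvg W f N‖ < ε := by
  intro ε hε
  obtain ⟨hW, l, hl⟩ := hW
  have hpos := eventually_dd_pos hW hl
  have hpos' := (tendsto_add_atTop_nat 1).eventually hpos
  have hl' := hl.comp (tendsto_add_atTop_nat 1)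
  rcases lt_or_ge ((-1 : ℝ) : EReal) l with h | h
  · obtain ⟨c, hc1, hcl⟩ := EReal.lt_iff_exists_real_btwn.1 h
    rw [EReal.coe_lt_coe_iff] at hc1
    have hδ : 0 < c + 1 := by linarith
    refine absurd hlog (not_tendsto_log_div_log hW.2.2 (half_pos hδ)
      (exists_dd_ge_of_ratio_gt hW.2.2 hδ ?_))
    filter_upwards [hl'.eventually_const_lt hcl, hpos', eventually_ge_atTop 1] with n hn hp hn1
    simp only [Function.comp_apply, EReal.coe_lt_coe_iff] at hn
    rw [lt_div_iff₀ hp, dd_succ (dd W) hn1] at hn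
    push_cast at hn
    linarith
  · set η := ε / 10
    have hη : 0 < η := by positivity
    have hlt : l < ((-(1 / (1 + η)) : ℝ) : EReal) := by
      refine h.trans_lt (EReal.coe_lt_coe_iff.2 (neg_lt_neg ?_))
      rw [div_lt_one (by positivity)]
      linarith
    have hclose := eventually_average_close W hW.2.2 hη (eventually_dd_nonneg hW) (by
      filter_upwards [hl'.eventually_lt_const hlt, hpos', eventually_ge_atTop 1] with n hn hp hn1
      simp only [Function.comp_apply, EReal.coe_lt_coe_iff] at hn
      rw [dd_succ (dd W) hn1, div_lt_iff₀ hp] at hn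
      rw [div_le_iff₀ (by positivity)]
      have := mul_lt_mul_of_pos_left hn (by positivity : 0 < 1 + η)
      field_simp at this
      linarith)
    filter_upwards [hclose] with N hN f hf
    refine (hN f hf).trans_lt ?_
    simp only [η]
    linarith
end

section
/- Let W : ℕ → [0,∞) be given by W(N) = exp(√N). Let f : ℕ → ℂ be any function and ℓ ∈ ℂ, and suppose E^W_{n≤N} f(n) → ℓ as N → ∞. Then E^{bin}_{n≤N} f(n) → ℓ and E^{2bin}_{n≤N} f(n) → ℓ as N → ∞. -/
open Filter Finset

open Topology in
/-- Silverman–Toeplitz: null sequences are sent to null sequences by row-bounded matrices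
whose columns tend to zero. -/
lemma tendsto_sum_mul_zero_of_toeplitz (c : ℕ → ℕ → ℝ) (A : ℕ → ℂ) (M : ℕ → ℕ) (C : ℝ)
    (hA : Tendsto A atTop (𝓝 0)) (hcol : ∀ n, Tendsto (fun N => c N n) atTop (𝓝 0))
    (hrow : ∀ N, ∑ n ∈ range (M N), |c N n| ≤ C) :
    Tendsto (fun N => ∑ n ∈ range (M N), (c N n : ℂ) * A n) atTop (𝓝 0) := by
  have hC : 0 ≤ C := (Finset.sum_nonneg fun _ _ => abs_nonneg _).trans (hrow 0)
  rw [Metric.tendsto_atTop]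
  intro ε hε
  obtain ⟨n₀, hn₀⟩ := Metric.tendsto_atTop.1 hA (ε / (2 * (C + 1))) (by positivity)
  have hfin : Tendsto (fun N => ∑ n ∈ range n₀, |c N n| * ‖A n‖) atTop (𝓝 0) := by
    have := tendsto_finsetSum (range n₀) fun n _ => ((hcol n).abs.mul_const ‖A n‖)
    simpa using this
  obtain ⟨N₀, hN₀⟩ := Metric.tendsto_atTop.1 hfin (ε / 2) (by positivity)
  refine ⟨N₀, fun N hN => ?_⟩
  have h1 := hN₀ N hN
  rw [Real.dist_0_eq_abs, abs_of_nonneg (Finset.sum_nonneg fun _ _ => by positivity)] at h1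
  rw [dist_zero_right]
  have hterm : ∀ n, ‖(c N n : ℂ) * A n‖ ≤
      |c N n| * (ε / (2 * (C + 1))) + if n < n₀ then |c N n| * ‖A n‖ else 0 := by
    intro n
    rw [norm_mul, Complex.norm_real, Real.norm_eq_abs]
    split_ifs with hn
    · have : 0 ≤ |c N n| * (ε / (2 * (C + 1))) := by positivity
      linarith
    · have := hn₀ n (by omega)
      rw [dist_zero_right] at this
      rw [add_zero]
      gcongr
  have hsmall : ∑ n ∈ range (M N), (if n < n₀ then |c N n| * ‖A n‖ else 0) ≤
      ∑ n ∈ range n₀, |c N n| * ‖A n‖ := by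
    rw [← Finset.sum_filter]
    refine Finset.sum_le_sum_of_subset_of_nonneg (fun n hn => ?_) fun _ _ _ => by positivity
    simpa using (Finset.mem_filter.1 hn).2
  have hbig : (∑ n ∈ range (M N), |c N n|) * (ε / (2 * (C + 1))) ≤ ε / 2 := by
    calc (∑ n ∈ range (M N), |c N n|) * (ε / (2 * (C + 1)))
        ≤ (C + 1) * (ε / (2 * (C + 1))) := by gcongr; linarith [hrow N]
      _ = ε / 2 := by field_simp
  calc ‖∑ n ∈ range (M N), (c N n : ℂ) * A n‖
      ≤ ∑ n ∈ range (M N), ‖(c N n : ℂ) * A n‖ := norm_sum_le _ _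
    _ ≤ ∑ n ∈ range (M N), (|c N n| * (ε / (2 * (C + 1))) +
          if n < n₀ then |c N n| * ‖A n‖ else 0) := Finset.sum_le_sum fun n _ => hterm n
    _ = (∑ n ∈ range (M N), |c N n|) * (ε / (2 * (C + 1))) +
          ∑ n ∈ range (M N), (if n < n₀ then |c N n| * ‖A n‖ else 0) := by
        rw [Finset.sum_add_distrib, Finset.sum_mul]
    _ < ε := by linarith

/-- Summation by parts. -/
lemma sum_mul_sub_eq_sum_sub_mul {R : Type*} [CommRing R] (g S : ℕ → R) (M : ℕ) :
    ∑ n ∈ range M, g n * (S (n + 1) - S n) =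
      ∑ n ∈ range M, (g n - g (n + 1)) * S (n + 1) + g M * S M - g 0 * S 0 := by
  induction M with
  | zero => simp
  | succ k ih => rw [Finset.sum_range_succ, Finset.sum_range_succ, ih]; ring

/-- The total variation of a nonnegative unimodal sequence is at most twice its maximum. -/
lemma sum_abs_sub_le_of_unimodal (p : ℕ → ℝ) (m : ℕ) (hp : ∀ n, 0 ≤ p n)
    (hmono : ∀ n, n < m → p n ≤ p (n + 1)) (hanti : ∀ n, m ≤ n → p (n + 1) ≤ p n) (K : ℕ) :
    ∑ n ∈ range K, |p n - p (n + 1)| ≤ 2 * p m := by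
  have key : ∑ n ∈ range K, |p n - p (n + 1)| ≤ if K ≤ m then p K else 2 * p m - p K := by
    induction K with
    | zero => simpa using hp 0
    | succ k ih =>
      rw [Finset.sum_range_succ]
      rcases lt_trichotomy k m with hk | hk | hk
      · rw [if_pos hk.le] at ih
        rw [if_pos (by omega), abs_of_nonpos (by linarith [hmono k hk])]
        linarith
      · subst hk
        rw [if_pos le_rfl] at ih
        rw [if_neg (by omega), abs_of_nonneg (by linarith [hanti k le_rfl])]
        linarith
      · rw [if_neg (by omega)] at ih
        rw [if_neg (by omega), abs_of_nonneg (by linarith [hanti k hk.le])]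
        linarith
  have hle : ∀ i, K ≤ i → i ≤ m → p K ≤ p i := by
    intro i hi
    induction i, hi using Nat.le_induction with
    | base => exact fun _ => le_rfl
    | succ i _ ih => exact fun h => (ih (by omega)).trans (hmono i (by omega))
  split_ifs at key with h
  · linarith [hle m h le_rfl, hp m]
  · linarith [hp K]

lemma sum_Icc_one_eq_sum_range {R : Type*} [AddCommMonoid R] (F : ℕ → R) (M : ℕ) :
    ∑ n ∈ Icc 1 M, F n = ∑ n ∈ range M, F (n + 1) := by
  induction M with
  | zero => simp
  | succ k ih => rw [Finset.sum_Icc_succ_top (by omega), ih, Finset.sum_range_succ]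

lemma sum_Icc_dd (W : ℕ → ℝ) (N : ℕ) (hN : 1 ≤ N) : ∑ n ∈ Icc 1 N, dd W n = W N := by
  induction N, hN using Nat.le_induction with
  | base => simp [dd]
  | succ k hk ih =>
    rw [Finset.sum_Icc_succ_top (by omega), ih, dd, if_pos (by omega)]
    simp

/-- For `W(N) = exp(√N)`, the quotient `W(n+1) / ΔW(n+1)` lies within `1` above
`√(n+1) + √n`. -/
lemma dd_exp_sqrt_bounds (W : ℕ → ℝ) (hW : ∀ N : ℕ, W N = Real.exp (Real.sqrt N)) (n : ℕ) :
    0 < dd W (n + 1) ∧ √((n : ℝ) + 1) + √(n : ℝ) ≤ W (n + 1) / dd W (n + 1) ∧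
      W (n + 1) / dd W (n + 1) ≤ √((n : ℝ) + 1) + √(n : ℝ) + 1 := by
  rcases Nat.eq_zero_or_pos n with rfl | hn
  · simp [dd, hW, (Real.exp_pos 1).ne', Real.exp_pos]
  set a := √((n : ℝ) + 1)
  set b := √(n : ℝ)
  have ha : a ^ 2 = n + 1 := Real.sq_sqrt (by positivity)
  have hb : b ^ 2 = n := Real.sq_sqrt (by positivity)
  have ha0 : 0 < a := Real.sqrt_pos.2 (by positivity)
  have hb0 : 0 ≤ b := Real.sqrt_nonneg _
  have hds : (a - b) * (a + b) = 1 := by nlinarith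
  have hd : 0 < a - b := by
    by_contra hcon
    nlinarith
  have hddef : dd W (n + 1) = W (n + 1) * (1 - Real.exp (-(a - b))) := by
    rw [dd, if_pos (by omega), mul_sub, hW, hW, ← Real.exp_add]
    simp only [Nat.cast_add, Nat.cast_one, Nat.add_sub_cancel, mul_one]
    congr 2
    ring
  have hWpos : 0 < W (n + 1) := by rw [hW]; exact Real.exp_pos _
  have hlow : 1 - Real.exp (-(a - b)) ≤ a - b := by
    linarith [Real.add_one_le_exp (-(a - b))]
  have he : Real.exp (-(a - b)) * (1 + (a - b)) ≤ 1 := by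
    calc _ ≤ Real.exp (-(a - b)) * Real.exp (a - b) := by
          gcongr
          linarith [Real.add_one_le_exp (a - b)]
      _ = 1 := by rw [← Real.exp_add]; simp
  have hpos : 0 < 1 - Real.exp (-(a - b)) := by
    have : Real.exp (-(a - b)) < 1 := Real.exp_lt_one_iff.2 (by linarith)
    linarith
  have hr : W (n + 1) / dd W (n + 1) = 1 / (1 - Real.exp (-(a - b))) := by
    rw [hddef]
    field_simp
  rw [hr]
  refine ⟨by rw [hddef]; positivity, ?_, ?_⟩
  · rw [le_div_iff₀ hpos]
    nlinarith
  · rw [div_le_iff₀ hpos]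
    nlinarith

lemma centralBinom_sq_mul_le (n : ℕ) : n.centralBinom ^ 2 * (2 * n + 1) ≤ 16 ^ n := by
  induction n with
  | zero => simp
  | succ n ih =>
    have h := Nat.succ_mul_centralBinom_succ n
    refine Nat.le_of_mul_le_mul_left (c := (n + 1) ^ 2) ?_ (by positivity)
    calc (n + 1) ^ 2 * ((n + 1).centralBinom ^ 2 * (2 * (n + 1) + 1))
        = ((n + 1) * (n + 1).centralBinom) ^ 2 * (2 * n + 3) := by ring
      _ = (n.centralBinom ^ 2 * (2 * n + 1)) * (4 * ((2 * n + 1) * (2 * n + 3))) := by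
          rw [h]; ring
      _ ≤ 16 ^ n * (4 * ((2 * n + 2) * (2 * n + 2))) := by
          gcongr ?_ * (4 * ?_)
          nlinarith
      _ = (n + 1) ^ 2 * 16 ^ (n + 1) := by ring

lemma choose_half_sq_mul_le (N : ℕ) : (N.choose (N / 2)) ^ 2 * (N + 1) ≤ 4 ^ N := by
  rcases Nat.even_or_odd' N with ⟨n, rfl | rfl⟩
  · have h := centralBinom_sq_mul_le n
    rw [Nat.centralBinom_eq_two_mul_choose] at h
    rw [Nat.mul_div_cancel_left n (by norm_num), pow_mul]
    exact h
  · have h := centralBinom_sq_mul_le (n + 1)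
    have h2 : (n + 1).centralBinom = 2 * (2 * n + 1).choose n := by
      rw [Nat.centralBinom_eq_two_mul_choose, show 2 * (n + 1) = (2 * n + 1) + 1 by ring,
        Nat.choose_succ_succ, Nat.choose_symm_half]
      ring
    rw [h2] at h
    rw [show (2 * n + 1) / 2 = n by omega]
    have h3 : (16 : ℕ) ^ (n + 1) = 4 * 4 ^ (2 * n + 1) := by
      rw [pow_succ, pow_succ, pow_mul]; norm_num; ring
    nlinarith

lemma choose_div_two_pow_le (N k : ℕ) :
    (N.choose k : ℝ) / 2 ^ N ≤ 1 / √((N : ℝ) + 1) := by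
  have h1 : (N.choose k : ℝ) ≤ N.choose (N / 2) := by exact_mod_cast Nat.choose_le_middle k N
  have h2 : ((N.choose (N / 2) : ℝ)) ^ 2 * (N + 1) ≤ (2 ^ N) ^ 2 := by
    rw [← pow_mul, mul_comm N 2, pow_mul]
    have := choose_half_sq_mul_le N
    norm_num
    exact_mod_cast this
  have hs : √((N : ℝ) + 1) ^ 2 = N + 1 := Real.sq_sqrt (by positivity)
  rw [div_le_div_iff₀ (by positivity) (Real.sqrt_pos.2 (by positivity)), one_mul]
  refine (mul_le_mul_of_nonneg_right h1 (Real.sqrt_nonneg _)).trans ?_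
  refine le_of_sq_le_sq ?_ (by positivity)
  rw [mul_pow, hs]
  exact h2

open Topology in
/-- Averages against unimodal probability weights on `[1, 2N]` of height `O(N^{-1/2})` are
subordinate to the weighted averages for `W(N) = exp(√N)`. -/
lemma tendsto_unimodal_mean (W : ℕ → ℝ) (hW : ∀ N : ℕ, W N = Real.exp (Real.sqrt N))
    (f : ℕ → ℂ) (ℓ : ℂ) (h : Tendsto (fun N : ℕ => wAvg W f N) atTop (𝓝 ℓ))
    (p : ℕ → ℕ → ℝ) (m : ℕ → ℕ) (hp : ∀ N n, 0 ≤ p N n)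
    (hsupp : ∀ N n, 2 * N < n → p N n = 0)
    (hmono : ∀ N n, n < m N → p N n ≤ p N (n + 1))
    (hanti : ∀ N n, m N ≤ n → p N (n + 1) ≤ p N n)
    (hmax : ∀ N n, p N n ≤ 1 / √((N : ℝ) + 1))
    (hsum : ∀ N, ∑ n ∈ Icc 1 (2 * N), p N n = 1 - (1 / 2) ^ N) :
    Tendsto (fun N => ∑ n ∈ Icc 1 (2 * N), (p N n : ℂ) * f n) atTop (𝓝 ℓ) := by
  have hWpos : ∀ n, 0 < W n := fun n => by rw [hW]; exact Real.exp_pos _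
  have hw := dd_exp_sqrt_bounds W hW
  set r : ℕ → ℝ := fun n => W n / dd W n with hr
  set S : ℕ → ℂ := fun n => ∑ k ∈ Icc 1 n, (dd W k : ℂ) * (f k - ℓ) with hS
  set A : ℕ → ℂ := fun n => S (n + 1) / (W (n + 1) : ℂ) with hAdef
  set c : ℕ → ℕ → ℝ := fun N n => r (n + 1) * p N (n + 1) - (r (n + 2) - 1) * p N (n + 2)
    with hc
  have hA : Tendsto A atTop (𝓝 0) := by
    have h1 : Tendsto (fun n => wAvg W f (n + 1) - ℓ) atTop (𝓝 (ℓ - ℓ)) :=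
      (h.comp (tendsto_add_atTop_nat 1)).sub_const ℓ
    rw [sub_self] at h1
    refine h1.congr fun n => ?_
    have hne : (W (n + 1) : ℂ) ≠ 0 := by exact_mod_cast (hWpos _).ne'
    have hd : (∑ k ∈ Icc 1 (n + 1), (dd W k : ℂ)) = W (n + 1) := by
      exact_mod_cast sum_Icc_dd W (n + 1) (by omega)
    simp only [hAdef, hS, mul_sub, Finset.sum_sub_distrib, ← Finset.sum_mul, hd, wAvg]
    field_simp
  have hs1 : Tendsto (fun N : ℕ => 1 / √((N : ℝ) + 1)) atTop (𝓝 0) := by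
    simp_rw [one_div]
    exact tendsto_inv_atTop_zero.comp (Real.tendsto_sqrt_atTop.comp
      (tendsto_atTop_add_const_right _ _ tendsto_natCast_atTop_atTop))
  have hpcol : ∀ n, Tendsto (fun N => p N n) atTop (𝓝 0) := fun n =>
    squeeze_zero (fun N => hp N n) (fun N => hmax N n) hs1
  have hcol : ∀ n, Tendsto (fun N => c N n) atTop (𝓝 0) := fun n => by
    simpa using ((hpcol (n + 1)).const_mul (r (n + 1))).sub
      ((hpcol (n + 2)).const_mul (r (n + 2) - 1))
  have hpsum : ∀ N, ∑ n ∈ range (2 * N), p N (n + 2) ≤ 1 := by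
    intro N
    calc ∑ n ∈ range (2 * N), p N (n + 2)
        ≤ ∑ n ∈ range (2 * N + 1), p N (n + 1) := by
          rw [Finset.sum_range_succ' (fun n => p N (n + 1))]
          linarith [hp N (0 + 1)]
      _ = 1 - (1 / 2) ^ N := by
          rw [Finset.sum_range_succ, hsupp N (2 * N + 1) (by omega), add_zero,
            ← sum_Icc_one_eq_sum_range, hsum]
      _ ≤ 1 := by linarith [show (0 : ℝ) ≤ (1 / 2) ^ N by positivity]
  have hcterm : ∀ N n, n < 2 * N →
      |c N n| ≤ 4 * √((N : ℝ) + 1) * |p N (n + 1) - p N (n + 2)| + 2 * p N (n + 2) := by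
    intro N n hn
    obtain ⟨-, hl1, hu1⟩ := hw n
    obtain ⟨-, hl2, hu2⟩ := hw (n + 1)
    have hn' : (n : ℝ) + 1 ≤ 2 * N := by exact_mod_cast hn
    push_cast at hl2 hu2
    have hx0 := Real.sqrt_nonneg (n : ℝ)
    have hx01 : √(n : ℝ) ≤ √((n : ℝ) + 1) := Real.sqrt_le_sqrt (by linarith)
    have hx12 : √((n : ℝ) + 1) ≤ √((n : ℝ) + 1 + 1) := Real.sqrt_le_sqrt (by linarith)
    have hx02 : √((n : ℝ) + 1 + 1) ≤ √(n : ℝ) + 2 := by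
      rw [Real.sqrt_le_left (by positivity)]
      nlinarith [Real.sq_sqrt (show (0 : ℝ) ≤ n by positivity)]
    have hr0 : 0 ≤ r (n + 1) := le_trans (by positivity) hl1
    have hrle : r (n + 1) ≤ 4 * √((N : ℝ) + 1) := by
      have h1 : √((n : ℝ) + 1) ≤ 1.5 * √((N : ℝ) + 1) := by
        rw [Real.sqrt_le_left (by positivity), mul_pow, Real.sq_sqrt (by positivity)]
        linarith
      have h2 : 1 ≤ √((N : ℝ) + 1) := Real.one_le_sqrt.2 (by
        linarith [show (0 : ℝ) ≤ N by positivity])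
      linarith
    have hdiff : |r (n + 1) - r (n + 2) + 1| ≤ 2 := by
      rw [abs_le]
      constructor <;> simp only [hr] <;> linarith
    calc |c N n| = |r (n + 1) * (p N (n + 1) - p N (n + 2)) +
            (r (n + 1) - r (n + 2) + 1) * p N (n + 2)| := by
          simp only [hc]; ring_nf
      _ ≤ r (n + 1) * |p N (n + 1) - p N (n + 2)| +
            |r (n + 1) - r (n + 2) + 1| * p N (n + 2) := by
          refine (abs_add_le _ _).trans_eq ?_
          rw [abs_mul, abs_mul, abs_of_nonneg hr0, abs_of_nonneg (hp N (n + 2))]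
      _ ≤ _ := by
          have := hp N (n + 2)
          gcongr
  have hrow : ∀ N, ∑ n ∈ range (2 * N), |c N n| ≤ 10 := by
    intro N
    have hTV : ∑ n ∈ range (2 * N), |p N (n + 1) - p N (n + 2)| ≤ 2 * (1 / √((N : ℝ) + 1)) := by
      have h1 := sum_abs_sub_le_of_unimodal (p N) (m N) (hp N) (hmono N) (hanti N) (2 * N + 1)
      rw [Finset.sum_range_succ'] at h1
      linarith [abs_nonneg (p N 0 - p N (0 + 1)), hmax N (m N)]
    have hpos : 0 < √((N : ℝ) + 1) := Real.sqrt_pos.2 (by positivity)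
    calc ∑ n ∈ range (2 * N), |c N n|
        ≤ ∑ n ∈ range (2 * N), (4 * √((N : ℝ) + 1) * |p N (n + 1) - p N (n + 2)| +
            2 * p N (n + 2)) :=
          Finset.sum_le_sum fun n hn => hcterm N n (Finset.mem_range.1 hn)
      _ = 4 * √((N : ℝ) + 1) * ∑ n ∈ range (2 * N), |p N (n + 1) - p N (n + 2)| +
            2 * ∑ n ∈ range (2 * N), p N (n + 2) := by
          rw [Finset.sum_add_distrib, Finset.mul_sum, Finset.mul_sum]
      _ ≤ 4 * √((N : ℝ) + 1) * (2 * (1 / √((N : ℝ) + 1))) + 2 * 1 := by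
          gcongr
          exact hpsum N
      _ = 10 := by field_simp; norm_num
  have hzero := tendsto_sum_mul_zero_of_toeplitz c A (fun N => 2 * N) 10 hA hcol hrow
  have hmass : Tendsto (fun N : ℕ => ((1 - (1 / 2) ^ N : ℝ) : ℂ) * ℓ) atTop (𝓝 ℓ) := by
    have h1 : Tendsto (fun N : ℕ => (1 - (1 / 2) ^ N : ℝ)) atTop (𝓝 (1 - 0)) :=
      (tendsto_pow_atTop_nhds_zero_of_lt_one (by norm_num) (by norm_num)).const_sub 1
    have h2 := ((Complex.continuous_ofReal.tendsto _).comp h1).mul_const ℓ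
    simpa using h2
  have hfinal := hzero.add hmass
  rw [zero_add] at hfinal
  refine hfinal.congr fun N => ?_
  have hcA : ∀ n, (c N n : ℂ) * A n =
      (((p N (n + 1) / dd W (n + 1) : ℝ) : ℂ) - ((p N (n + 2) / dd W (n + 2) : ℝ) : ℂ)) *
        S (n + 1) := by
    intro n
    have hne : (W (n + 1) : ℂ) ≠ 0 := by exact_mod_cast (hWpos _).ne'
    have hcoef : c N n =
        (p N (n + 1) / dd W (n + 1) - p N (n + 2) / dd W (n + 2)) * W (n + 1) := by
      have h1 := (hw n).1.ne'
      have h2 : dd W (n + 2) ≠ 0 := (hw (n + 1)).1.ne'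
      have h3 : W (n + 2) = dd W (n + 2) + W (n + 1) := by
        rw [dd, if_pos (by omega)]
        simp
      simp only [hc, hr]
      rw [h3]
      field_simp
      ring
    rw [hcoef]
    simp only [hAdef]
    push_cast
    field_simp
  have habel := sum_mul_sub_eq_sum_sub_mul
    (fun n => ((p N (n + 1) / dd W (n + 1) : ℝ) : ℂ)) S (2 * N)
  have hS0 : S 0 = 0 := by simp [hS]
  simp only [hS0, hsupp N (2 * N + 1) (by omega), zero_div, Complex.ofReal_zero, zero_mul,
    mul_zero, add_zero, sub_zero] at habel
  rw [Finset.sum_congr rfl fun n _ => hcA n, ← habel, ← hsum N, Complex.ofReal_sum,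
    Finset.sum_mul, sum_Icc_one_eq_sum_range, sum_Icc_one_eq_sum_range,
    ← Finset.sum_add_distrib]
  refine Finset.sum_congr rfl fun n _ => ?_
  have hne : (dd W (n + 1) : ℂ) ≠ 0 := by exact_mod_cast (hw n).1.ne'
  have hstep : S (n + 1) - S n = (dd W (n + 1) : ℂ) * (f (n + 1) - ℓ) := by
    simp only [hS]
    rw [Finset.sum_Icc_succ_top (by omega)]
    ring
  rw [hstep]
  push_cast
  field_simp
  ring

lemma choose_le_choose_succ {N k : ℕ} (h : k < N / 2) : N.choose k ≤ N.choose (k + 1) :=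
  Nat.choose_le_succ_of_lt_half_left h

lemma choose_succ_le_choose {N k : ℕ} (h : N / 2 ≤ k) : N.choose (k + 1) ≤ N.choose k := by
  have h1 := Nat.choose_succ_right_eq N k
  refine Nat.le_of_mul_le_mul_right (c := k + 1) ?_ (by omega)
  rw [h1]
  exact Nat.mul_le_mul_left _ (by omega)

lemma sum_choose_half (N M : ℕ) :
    ∑ n ∈ range (2 * M), (N.choose (n / 2) : ℝ) = 2 * ∑ k ∈ range M, (N.choose k : ℝ) := by
  induction M with
  | zero => simp
  | succ M ih =>
    rw [show 2 * (M + 1) = 2 * M + 1 + 1 by ring, Finset.sum_range_succ, Finset.sum_range_succ,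
      ih, Finset.sum_range_succ, show 2 * M / 2 = M by omega, show (2 * M + 1) / 2 = M by omega]
    ring

lemma sum_range_choose_real (N : ℕ) : ∑ k ∈ range (N + 1), (N.choose k : ℝ) = 2 ^ N := by
  exact_mod_cast Nat.sum_range_choose N

/-- Lemma 5.7: convergence of `E^W`-averages with `W(N) = e^{√N}`
implies convergence of the binomial and parity-neutral binomial means to the same limit. -/
theorem stmt17 (W : ℕ → ℝ) (hWdef : ∀ N : ℕ, W N = Real.exp (Real.sqrt N))
    (f : ℕ → ℂ) (ℓ : ℂ)
    (h : Tendsto (fun N : ℕ => wAvg W f N) atTop (nhds ℓ)) :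
    Tendsto (fun N : ℕ => ebin f N) atTop (nhds ℓ) ∧
    Tendsto (fun N : ℕ => e2bin f N) atTop (nhds ℓ) := by
  constructor
  · have key := tendsto_unimodal_mean W hWdef f ℓ h (fun N n => (N.choose n : ℝ) / 2 ^ N)
      (fun N => N / 2) (fun N n => by positivity)
      (fun N n hn => by simp [Nat.choose_eq_zero_of_lt (show N < n by omega)])
      (fun N n hn => by
        have := choose_le_choose_succ hn
        gcongr)
      (fun N n hn => by
        have := choose_succ_le_choose hn
        gcongr)
      choose_div_two_pow_le
      (fun N => by
        have h1 := sum_range_choose_real N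
        rw [Finset.sum_range_succ', ← sum_Icc_one_eq_sum_range (fun n => (N.choose n : ℝ))] at h1
        have h2 : ∑ n ∈ Icc 1 (2 * N), (N.choose n : ℝ) = ∑ n ∈ Icc 1 N, (N.choose n : ℝ) := by
          refine (Finset.sum_subset (Finset.Icc_subset_Icc_right (by omega)) ?_).symm
          intro n hn hn'
          simp only [Finset.mem_Icc] at hn hn'
          rw [Nat.choose_eq_zero_of_lt (by omega), Nat.cast_zero]
        rw [← Finset.sum_div, h2, div_eq_iff (by positivity), sub_mul, ← mul_pow]
        norm_num at h1 ⊢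
        linarith)
    refine key.congr fun N => ?_
    rw [ebin, Finset.mul_sum]
    symm
    refine (Finset.sum_subset (Finset.Icc_subset_Icc_right (show N ≤ 2 * N by omega)) ?_).trans ?_
    · intro n hn hn'
      simp only [Finset.mem_Icc] at hn hn'
      simp [Nat.choose_eq_zero_of_lt (show N < n by omega)]
    · refine Finset.sum_congr rfl fun n _ => ?_
      push_cast
      ring
  · have key := tendsto_unimodal_mean W hWdef f ℓ h
      (fun N n => if n ≤ 2 * N then (N.choose (n / 2) : ℝ) / 2 ^ (N + 1) else 0)
      (fun N => 2 * (N / 2)) (fun N n => by split_ifs <;> positivity)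
      (fun N n hn => if_neg (by omega))
      (fun N n hn => by
        rw [if_pos (by omega), if_pos (by omega)]
        rcases Nat.even_or_odd' n with ⟨k, rfl | rfl⟩
        · rw [show 2 * k / 2 = k by omega, show (2 * k + 1) / 2 = k by omega]
        · rw [show (2 * k + 1) / 2 = k by omega, show (2 * k + 1 + 1) / 2 = k + 1 by omega]
          have := choose_le_choose_succ (show k < N / 2 by omega)
          gcongr)
      (fun N n hn => by
        by_cases hn2 : n + 1 ≤ 2 * N
        · rw [if_pos hn2, if_pos (by omega)]
          rcases Nat.even_or_odd' n with ⟨k, rfl | rfl⟩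
          · rw [show 2 * k / 2 = k by omega, show (2 * k + 1) / 2 = k by omega]
          · rw [show (2 * k + 1) / 2 = k by omega, show (2 * k + 1 + 1) / 2 = k + 1 by omega]
            have := choose_succ_le_choose (show N / 2 ≤ k by omega)
            gcongr
        · rw [if_neg hn2]
          split_ifs <;> positivity)
      (fun N n => by
        split_ifs
        · refine le_trans ?_ (choose_div_two_pow_le N (n / 2))
          gcongr
          · norm_num
          · omega
        · positivity)
      (fun N => by
        rw [Finset.sum_congr rfl fun n hn => if_pos (Finset.mem_Icc.1 hn).2]
        have h1 := sum_choose_half N (N + 1)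
        rw [sum_range_choose_real, show 2 * (N + 1) = 2 * N + 1 + 1 by ring,
          Finset.sum_range_succ, Finset.sum_range_succ',
          ← sum_Icc_one_eq_sum_range (fun n => (N.choose (n / 2) : ℝ)),
          show (2 * N + 1) / 2 = N by omega] at h1
        have h2 : (1 / 2 : ℝ) ^ N * (2 ^ N * 2) = 2 := by
          rw [← mul_assoc, ← mul_pow]
          norm_num
        rw [← Finset.sum_div, div_eq_iff (by positivity), pow_succ, sub_mul, h2]
        norm_num at h1 ⊢
        linarith)
    refine key.congr fun N => ?_
    rw [e2bin, Finset.mul_sum]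
    refine Finset.sum_congr rfl fun n hn => ?_
    rw [if_pos (Finset.mem_Icc.1 hn).2]
    push_cast
    ring
end
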